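/- (Main exponential stabilization result, Proposition 3.1.) For every t ≥ 0 the Lyapunov function satisfies L(t) ≤ L(0) · exp( (2/η) v'_max ρ_min t ); in particular, since v'_max < 0 and ρ_min > 0, L(t) decays exponentially to 0 as t → ∞. -/

import Mathlib

open MeasureTheory intervalIntegral Set Filter

/-- Leibniz rule: differentiation under the integral sign over a compact interval, for a
parametrised function whose partial derivative is jointly continuous. -/
lemma hasDerivAt_intervalIntegral_of_continuousOn {f f' : ℝ → ℝ → ℝ} {U : Set ℝ} (hU : IsOpen U)
    (hf : ContinuousOn (fun p : ℝ × ℝ => f p.1 p.2) (U ×ˢ univ))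
    (hf' : ContinuousOn (fun p : ℝ × ℝ => f' p.1 p.2) (U ×ˢ univ))
    (hderiv : ∀ t ∈ U, ∀ s, HasDerivAt (fun τ => f τ s) (f' t s) t)
    {t : ℝ} (ht : t ∈ U) (a b : ℝ) :
    HasDerivAt (fun τ => ∫ s in a..b, f τ s) (∫ s in a..b, f' t s) t := by
  have slice : ∀ {g : ℝ → ℝ → ℝ}, ContinuousOn (fun p : ℝ × ℝ => g p.1 p.2) (U ×ˢ univ) →
      ∀ τ ∈ U, Continuous (g τ) := fun hg τ hτ =>
    hg.comp_continuous (f := fun s : ℝ => (τ, s)) (by fun_prop) fun s => ⟨hτ, mem_univ _⟩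
  obtain ⟨ε, hε, hball⟩ := Metric.nhds_basis_closedBall.mem_iff.1 (hU.mem_nhds ht)
  obtain ⟨C, hC⟩ := ((isCompact_closedBall t ε).prod (isCompact_uIcc (a := a) (b := b)))
    |>.exists_bound_of_continuousOn
      (hf'.mono (prod_mono hball (subset_univ _)))
  refine (hasDerivAt_integral_of_dominated_loc_of_deriv_le (bound := fun _ => C)
    (Metric.closedBall_mem_nhds t hε) ?_ ((slice hf t ht).intervalIntegrable _ _)
    (slice hf' t ht).aestronglyMeasurable ?_ intervalIntegrable_const ?_).2
  · filter_upwards [hU.mem_nhds ht] with τ hτ using (slice hf τ hτ).aestronglyMeasurable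
  · exact ae_of_all _ fun s hs τ hτ => hC (τ, s) ⟨hτ, uIoc_subset_uIcc hs⟩
  · exact ae_of_all _ fun s _ τ hτ => hderiv τ (hball hτ) s

/-- The mean over `[x, x + η]` of a function with values in `[m, M]` lies in `[m, M]`. -/
lemma mean_mem_Icc {η m M x : ℝ} (hη : 0 < η) {g : ℝ → ℝ} (hg : Continuous g)
    (hmem : ∀ y, g y ∈ Icc m M) : (1 / η) * ∫ y in x..(x + η), g y ∈ Icc m M := by
  have hint := hg.intervalIntegrable (μ := volume) x (x + η)
  have lower := integral_mono_on (by linarith) intervalIntegrable_const hint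
    fun y _ => (hmem y).1
  have upper := integral_mono_on (by linarith) hint intervalIntegrable_const
    fun y _ => (hmem y).2
  simp only [intervalIntegral.integral_const, add_sub_cancel_left, smul_eq_mul] at lower upper
  rw [one_div, inv_mul_eq_div, mem_Icc, le_div_iff₀ hη, div_le_iff₀ hη]
  constructor <;> linarith

/-- The derivative of a moving average over a window of fixed length. -/
lemma hasDerivAt_mean {η : ℝ} {g : ℝ → ℝ} (hg : Continuous g) (x : ℝ) :
    HasDerivAt (fun x => (1 / η) * ∫ y in x..(x + η), g y)
      ((1 / η) * (g (x + η) - g x)) x := by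
  have hright := ((hg.integral_hasStrictDerivAt 0 (x + η)).hasDerivAt).comp_add_const x η
  have hleft := (hg.integral_hasStrictDerivAt 0 x).hasDerivAt
  refine ((hright.sub hleft).congr_of_eventuallyEq (Eventually.of_forall fun u => ?_)).const_mul _
  exact (integral_interval_sub_left (hg.intervalIntegrable _ _) (hg.intervalIntegrable _ _)).symm

/-- A continuous function with `y' = a y` where `a ≤ c / 2` has `y ^ 2` decaying at rate `c`. -/
lemma sq_le_sq_mul_exp_of_hasDerivAt {y a : ℝ → ℝ} {c : ℝ} (hy : ContinuousOn y (Ici 0))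
    (hderiv : ∀ t > 0, HasDerivAt y (a t * y t) t) (ha : ∀ t > 0, 2 * a t ≤ c)
    {t : ℝ} (ht : 0 ≤ t) : y t ^ 2 ≤ y 0 ^ 2 * Real.exp (c * t) := by
  have key : ∀ τ > 0, HasDerivAt (fun τ => y τ ^ 2 * Real.exp (-(c * τ)))
      ((2 * a τ - c) * (y τ ^ 2 * Real.exp (-(c * τ)))) τ := fun τ hτ => by
    have hexp := (((hasDerivAt_id τ).const_mul c).neg).exp
    refine (((hderiv τ hτ).pow 2).mul hexp).congr_deriv ?_
    simp only [Pi.pow_apply, Pi.neg_apply, id_eq]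
    push_cast
    ring
  have anti : AntitoneOn (fun τ => y τ ^ 2 * Real.exp (-(c * τ))) (Ici 0) := by
    refine antitoneOn_of_deriv_nonpos (convex_Ici 0) (by fun_prop) ?_ ?_ <;>
      rw [interior_Ici] <;> intro τ hτ
    · exact (key τ hτ).differentiableAt.differentiableWithinAt
    · rw [(key τ hτ).deriv]
      exact mul_nonpos_of_nonpos_of_nonneg (by linarith [ha τ hτ]) (by positivity)
  have h := anti (mem_Ici.2 le_rfl) (mem_Ici.2 ht) ht
  simp only [mul_zero, neg_zero, Real.exp_zero, mul_one, Real.exp_neg] at h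
  rwa [← div_eq_mul_inv, div_le_iff₀ (Real.exp_pos _)] at h

/-- **Main exponential stabilization result, Proposition 3.1.**
For every `t ≥ 0` the Lyapunov function satisfies
`L(t) ≤ L(0) · exp((2/η) v'_max ρ_min t)`; in particular, since `v'_max < 0` and
`ρ_min > 0`, `L(t)` decays exponentially to `0` as `t → ∞`. -/
theorem lyapunov_exponential_stabilization
    (η ρmax ρmin : ℝ) (hη : 0 < η) (hρmax : 0 < ρmax)
    (hρmin : 0 < ρmin) (hρminmax : ρmin ≤ ρmax)
    (v : ℝ → ℝ) (hv : ContDiffOn ℝ 2 v (Set.Icc 0 ρmax))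
    (v'max : ℝ) (hv'max : v'max < 0)
    (hv' : ∀ r ∈ Set.Icc (0 : ℝ) ρmax, deriv v r < 0)
    (hv'bound : ∀ r ∈ Set.Icc (0 : ℝ) ρmax, deriv v r ≤ v'max)
    (ρbar : ℝ) (hρbar : ρbar ∈ Set.Ioc 0 ρmax)
    (vbar b : ℝ) (hvbar : vbar = v ρbar)
    (β : ℝ → ℝ) (hβ : ∀ t, β t = b + vbar * t)
    (ρ : ℝ → ℝ → ℝ)
    (hρreg : ContDiffOn ℝ 1 (fun p : ℝ × ℝ => ρ p.1 p.2) (Set.Ici 0 ×ˢ Set.univ))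
    (hρrange : ∀ t ≥ (0 : ℝ), ∀ x, ρ t x ∈ Set.Icc ρmin ρmax)
    (hρeq : ∀ t ≥ (0 : ℝ), ∀ x, β t ≤ x → ρ t x = ρbar)
    (V : ℝ → ℝ → ℝ)
    (hV : ∀ t x, V t x = v ((1 / η) * ∫ y in x..(x + η), ρ t y))
    (hpde : ∀ t ≥ (0 : ℝ), ∀ x,
      derivWithin (fun s => ρ s x) (Set.Ici 0) t
        + deriv (fun y => ρ t y * V t y) x = 0)
    (L : ℝ → ℝ)
    (hL : ∀ t, L t = ∫ x in (β t - η)..(β t), (V t x - vbar) ^ 2) :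
    (∀ t ≥ (0 : ℝ), L t ≤ L 0 * Real.exp ((2 / η) * v'max * ρmin * t)) ∧
    Tendsto L atTop (nhds 0) := by
  have hFcont := hρreg.continuousOn
  have hρcont : ∀ t ≥ (0 : ℝ), Continuous (ρ t) := fun t ht =>
    hFcont.comp_continuous (f := fun s : ℝ => (t, s)) (by fun_prop) fun s => ⟨ht, mem_univ _⟩
  set w : ℝ → ℝ → ℝ := fun t x => (1 / η) * ∫ y in x..(x + η), ρ t y with hw
  have hVw : ∀ t x, V t x = v (w t x) := hV
  have hρIcc : ∀ t ≥ (0 : ℝ), ∀ x, ρ t x ∈ Icc 0 ρmax := fun t ht x =>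
    Icc_subset_Icc_left hρmin.le (hρrange t ht x)
  have hwmem : ∀ t ≥ (0 : ℝ), ∀ x, w t x ∈ Icc 0 ρmax := fun t ht x =>
    mean_mem_Icc hη (hρcont t ht) (hρIcc t ht)
  have hvd : ∀ r ∈ Icc (0 : ℝ) ρmax, HasDerivAt v (deriv v r) r := fun r hr =>
    (differentiableAt_of_deriv_ne_zero (hv' r hr).ne).hasDerivAt
  have hVx : ∀ t ≥ (0 : ℝ), ∀ x, HasDerivAt (V t)
      (deriv v (w t x) * ((1 / η) * (ρ t (x + η) - ρ t x))) x := fun t ht x => by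
    rw [show V t = v ∘ w t from funext (hVw t)]
    exact (hvd _ (hwmem t ht x)).comp x (hasDerivAt_mean (hρcont t ht) x)
  have hVcont : ∀ t ≥ (0 : ℝ), Continuous (V t) := fun t ht =>
    continuous_iff_continuousAt.2 fun x => (hVx t ht x).continuousAt
  have hVeq : ∀ t ≥ (0 : ℝ), ∀ x, β t ≤ x → V t x = vbar := fun t ht x hx => by
    have : ∫ y in x..(x + η), ρ t y = ∫ _ in x..(x + η), ρbar :=
      integral_congr fun y hy => hρeq t ht y <| by
        rw [uIcc_of_le (by linarith)] at hy
        exact hx.trans hy.1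
    rw [hV, this, hvbar, intervalIntegral.integral_const, smul_eq_mul, add_sub_cancel_left]
    congr 1
    field_simp
  -- the density and the averaged density in the frame moving with the boundary
  have hwframe : ∀ t z, w t (β t + z) = (1 / η) * ∫ s in z..(z + η), ρ t (β t + s) :=
    fun t z => by
      rw [intervalIntegral.integral_comp_add_left (fun y => ρ t y), hw]
      simp only [add_assoc]
  have hβd : ∀ t, HasDerivAt β vbar t := fun t => by
    rw [show β = fun t => b + vbar * t from funext hβ]
    simpa using ((hasDerivAt_id t).const_mul vbar).const_add b
  have hβcont : Continuous β := continuous_iff_continuousAt.2 fun t => (hβd t).continuousAt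
  set F : ℝ × ℝ → ℝ := fun p => ρ p.1 p.2
  have hopen : IsOpen (Ioi (0 : ℝ) ×ˢ (univ : Set ℝ)) := isOpen_Ioi.prod isOpen_univ
  have hFreg : ContDiffOn ℝ 1 F (Ioi 0 ×ˢ univ) :=
    hρreg.mono (prod_mono Ioi_subset_Ici_self subset_rfl)
  have hFd : ∀ t > (0 : ℝ), ∀ x, HasFDerivAt F (fderiv ℝ F (t, x)) (t, x) := fun t ht x =>
    ((hFreg.differentiableOn one_ne_zero).differentiableAt
      (hopen.mem_nhds (mk_mem_prod ht (mem_univ x)))).hasFDerivAt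
  have hF'cont : ContinuousOn (fderiv ℝ F) (Ioi 0 ×ˢ univ) :=
    hFreg.continuousOn_fderiv_of_isOpen hopen le_rfl
  set D : ℝ → ℝ → ℝ := fun t s => fderiv ℝ F (t, β t + s) (1, vbar) with hD
  have hmaps : MapsTo (fun p : ℝ × ℝ => (p.1, β p.1 + p.2)) (Ioi 0 ×ˢ univ) (Ioi 0 ×ˢ univ) :=
    fun p hp => ⟨hp.1, mem_univ _⟩
  have hDcont : ContinuousOn (fun p : ℝ × ℝ => D p.1 p.2) (Ioi 0 ×ˢ univ) :=
    (hF'cont.comp (by fun_prop) hmaps).clm_apply continuousOn_const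
  have hwd : ∀ t > (0 : ℝ), ∀ z, HasDerivAt (fun τ => w τ (β τ + z))
      ((1 / η) * ∫ s in z..(z + η), D t s) t := fun t ht z => by
    simp only [hwframe]
    refine (hasDerivAt_intervalIntegral_of_continuousOn isOpen_Ioi
      (f := fun t s => ρ t (β t + s)) (f' := D) ?_ hDcont ?_ ht z (z + η)).const_mul _
    · exact hFreg.continuousOn.comp (f := fun p : ℝ × ℝ => (p.1, β p.1 + p.2))
        (by fun_prop) hmaps
    · intro τ hτ s
      exact (hFd τ hτ (β τ + s)).comp_hasDerivAt τ
        ((hasDerivAt_id τ).prodMk ((hβd τ).add_const s))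
  -- the conservation law in the moving frame
  have hflux : ∀ t > (0 : ℝ), ∀ s, HasDerivAt
      (fun s => -(ρ t (β t + s) * (V t (β t + s) - vbar))) (D t s) s := fun t ht s => by
    set x := β t + s
    have hρt : HasDerivAt (fun τ => ρ τ x) (fderiv ℝ F (t, x) (1, 0)) t :=
      (hFd t ht x).comp_hasDerivAt (f := fun τ => (τ, x)) t ((hasDerivAt_id t).prodMk (hasDerivAt_const t x))
    have hρx : HasDerivAt (ρ t) (fderiv ℝ F (t, x) (0, 1)) x :=
      (hFd t ht x).comp_hasDerivAt (f := fun y => (t, y)) x ((hasDerivAt_const x t).prodMk (hasDerivAt_id x))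
    have hpde' := hpde t ht.le x
    rw [derivWithin_of_mem_nhds (Ici_mem_nhds ht), hρt.deriv] at hpde'
    have hprod : HasDerivAt (fun y => ρ t y * V t y) (-fderiv ℝ F (t, x) (1, 0)) x := by
      rw [← eq_neg_of_add_eq_zero_right hpde']
      exact (hρx.mul (hVx t ht.le x)).differentiableAt.hasDerivAt
    have hsplit : D t s = fderiv ℝ F (t, x) (1, 0) + vbar * fderiv ℝ F (t, x) (0, 1) := by
      rw [← smul_eq_mul, ← map_smul, ← map_add]
      simp [hD, x]
    have h := HasDerivAt.comp_const_add (β t) s (hprod.sub (hρx.const_mul vbar)).neg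
    refine (h.congr_of_eventuallyEq (Eventually.of_forall fun y => ?_)).congr_deriv ?_
    · simp only [Pi.neg_apply, Pi.sub_apply]
      ring
    · rw [hsplit]
      ring
  have hDint : ∀ t > (0 : ℝ), ∀ z ≥ -η, ∫ s in z..(z + η), D t s =
      ρ t (β t + z) * (V t (β t + z) - vbar) := fun t ht z hz => by
    have hcont : Continuous (D t) :=
      hDcont.comp_continuous (f := fun s : ℝ => (t, s)) (by fun_prop) fun s => ⟨ht, mem_univ _⟩
    rw [integral_eq_sub_of_hasDerivAt (fun s _ => hflux t ht s) (hcont.intervalIntegrable _ _),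
      hVeq t ht.le (β t + (z + η)) (by linarith)]
    ring
  have hwcont : ∀ z, ContinuousOn (fun t => w t (β t + z)) (Ici 0) := fun z => by
    have hext : Continuous fun p : ℝ × ℝ => ρ (max p.1 0) (β p.1 + p.2) :=
      hFcont.comp_continuous (f := fun p : ℝ × ℝ => (max p.1 0, β p.1 + p.2)) (by fun_prop)
        fun p => mk_mem_prod (le_max_right p.1 0) (mem_univ _)
    refine ((continuous_parametric_intervalIntegral_of_continuous' (μ := volume)
      (f := fun t s => ρ (max t 0) (β t + s)) hext z (z + η)).const_mul
        (1 / η)).continuousOn.congr fun t ht => ?_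
    simp only [hwframe, max_eq_left (mem_Ici.1 ht)]
  set c := (2 / η) * v'max * ρmin with hc
  have hpoint : ∀ t ≥ (0 : ℝ), ∀ z ≥ -η,
      (V t (β t + z) - vbar) ^ 2 ≤ (V 0 (β 0 + z) - vbar) ^ 2 * Real.exp (c * t) := by
    intro t ht z hz
    refine sq_le_sq_mul_exp_of_hasDerivAt (y := fun t => V t (β t + z) - vbar)
      (a := fun t => deriv v (w t (β t + z)) * ((1 / η) * ρ t (β t + z))) ?_ ?_ ?_ ht
    · simp only [hVw]
      exact (hv.continuousOn.comp (hwcont z) fun τ hτ => hwmem τ hτ _).sub continuousOn_const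
    · intro τ hτ
      have h := ((hvd _ (hwmem τ hτ.le (β τ + z))).comp τ (hwd τ hτ z)).sub_const vbar
      rw [hDint τ hτ z hz] at h
      simp only [hVw] at h ⊢
      exact h.congr_deriv (by ring)
    · intro τ hτ
      have hmul : deriv v (w τ (β τ + z)) * ρ τ (β τ + z) ≤ v'max * ρmin := by
        nlinarith [hv'bound _ (hwmem τ hτ.le (β τ + z)), (hρrange τ hτ.le (β τ + z)).1]
      calc 2 * (deriv v (w τ (β τ + z)) * ((1 / η) * ρ τ (β τ + z)))
          = (2 / η) * (deriv v (w τ (β τ + z)) * ρ τ (β τ + z)) := by ring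
        _ ≤ (2 / η) * (v'max * ρmin) := by gcongr
        _ = c := by rw [hc]; ring
  have hLframe : ∀ t, L t = ∫ z in (-η)..0, (V t (β t + z) - vbar) ^ 2 := fun t => by
    rw [hL, intervalIntegral.integral_comp_add_left (fun x => (V t x - vbar) ^ 2), add_zero,
      sub_eq_add_neg]
  have hUint : ∀ t ≥ (0 : ℝ), IntervalIntegrable (fun z => (V t (β t + z) - vbar) ^ 2)
      volume (-η) 0 := fun t ht => by
    have := hVcont t ht
    exact Continuous.intervalIntegrable (by fun_prop) _ _
  have hdecay : ∀ t ≥ (0 : ℝ), L t ≤ L 0 * Real.exp (c * t) := fun t ht => by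
    rw [hLframe, hLframe, ← intervalIntegral.integral_mul_const]
    exact integral_mono_on (by linarith) (hUint t ht) ((hUint 0 le_rfl).mul_const _)
      fun z hz => hpoint t ht z hz.1
  refine ⟨hdecay, ?_⟩
  have hcneg : c < 0 :=
    mul_neg_of_neg_of_pos (mul_neg_of_pos_of_neg (by positivity) hv'max) hρmin
  have hexp : Tendsto (fun t => L 0 * Real.exp (c * t)) atTop (nhds 0) := by
    simpa using (Real.tendsto_exp_atBot.comp
      (tendsto_id.const_mul_atTop_of_neg hcneg)).const_mul (L 0)
  refine tendsto_of_tendsto_of_tendsto_of_le_of_le' tendsto_const_nhds hexp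
    (Eventually.of_forall fun t => ?_) (eventually_ge_atTop 0 |>.mono hdecay)
  rw [hLframe]
  exact intervalIntegral.integral_nonneg (by linarith) fun z _ => sq_nonneg _
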